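/- Region-invariance of runs: let A be a one-clock timed automaton and let ρ be a run of A from the initial state with reset-logical-timed word γ_r=(σ1,μ1,b1)...(σn,μn,bn) (i.e. γ_r=Γ(trace_r(ρ))). Suppose μ1',...,μn'∈ℝ≥0 satisfy μi' ∈ ⟦μi⟧ for all i, μ1' ≥ 0, and μi' ≥ μ_{i-1}' whenever 2 ≤ i ≤ n and b_{i-1}=⊥. Then there is a run ρ' of A from the initial state taking exactly the same sequence of transitions as ρ whose reset-logical-timed word is (σ1,μ1',b1)...(σn,μn',bn); in particular ρ' is accepting if and only if ρ is accepting. -/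

import Mathlib

open scoped Classical NNReal

/-- Clock constraints over a single clock `c`:
`φ ::= ⊤ | c = m | c < m | c > m | c ≤ m | c ≥ m | φ ∧ φ` with `m ∈ ℕ`. -/
inductive ClockConstraint : Type where
  | top : ClockConstraint
  | eq (m : ℕ) : ClockConstraint
  | lt (m : ℕ) : ClockConstraint
  | gt (m : ℕ) : ClockConstraint
  | le (m : ℕ) : ClockConstraint
  | ge (m : ℕ) : ClockConstraint
  | conj (φ₁ φ₂ : ClockConstraint) : ClockConstraint

/-- Satisfaction of a clock constraint by a clock value `μ ∈ ℝ≥0`. -/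
def ClockConstraint.sat : ClockConstraint → ℝ≥0 → Prop
  | .top, _ => True
  | .eq m, μ => μ = (m : ℝ≥0)
  | .lt m, μ => μ < (m : ℝ≥0)
  | .gt m, μ => (m : ℝ≥0) < μ
  | .le m, μ => μ ≤ (m : ℝ≥0)
  | .ge m, μ => (m : ℝ≥0) ≤ μ
  | .conj φ₁ φ₂, μ => φ₁.sat μ ∧ φ₂.sat μ

/-- The region `⟦μ⟧` of a clock value: `[μ,μ]` if `μ ∈ ℕ`, and `(⌊μ⌋, ⌊μ⌋+1)` otherwise. -/
noncomputable def region (μ : ℝ≥0) : Set ℝ≥0 :=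
  if (⌊μ⌋₊ : ℝ≥0) = μ then {μ} else Set.Ioo (⌊μ⌋₊ : ℝ≥0) ((⌊μ⌋₊ : ℝ≥0) + 1)

/-- The normalization map `g_θ` : `μ ↦ μ` if `μ ∈ ℕ`, `μ ↦ ⌊μ⌋ + θ` otherwise. -/
noncomputable def gNorm (θ : ℝ≥0) (μ : ℝ≥0) : ℝ≥0 :=
  if (⌊μ⌋₊ : ℝ≥0) = μ then μ else (⌊μ⌋₊ : ℝ≥0) + θ

/-- Normalization of a reset-logical-timed word (normalizing each clock value). -/
noncomputable def normalizeWord {α : Type} (θ : ℝ≥0) (w : List (α × ℝ≥0 × Bool)) :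
    List (α × ℝ≥0 × Bool) :=
  w.map fun x => (x.1, gNorm θ x.2.1, x.2.2)

/-- A one-clock timed automaton (OTA) over the alphabet `α`: a finite set `Q` of
locations, an initial location `q0`, accepting locations `F`, and a finite set `Δ` of
transitions `(q, σ, φ, b, q')`, where `b` tells whether the clock is reset. -/
structure OTA (α : Type) where
  Q : Type
  [finQ : Finite Q]
  q0 : Q
  F : Set Q
  Δ : Set (Q × α × ClockConstraint × Bool × Q)
  finΔ : Δ.Finite

/-- One step of a run: delay `t`, action `σ`, guard `φ`, reset bit `b`, target location `tgt`. -/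
structure Step (α Q : Type) where
  t : ℝ≥0
  σ : α
  φ : ClockConstraint
  b : Bool
  tgt : Q

/-- The final location of a run starting at location `q`. -/
def endLoc {α Q : Type} (q : Q) (run : List (Step α Q)) : Q :=
  run.foldl (fun _ s => s.tgt) q

/-- The final clock valuation of a run starting with clock valuation `ν`. -/
def endVal {α Q : Type} (ν : ℝ≥0) (run : List (Step α Q)) : ℝ≥0 :=
  run.foldl (fun ν s => if s.b then 0 else ν + s.t) ν

/-- The trace (delay-timed word) `(σ₁,t₁)⋯(σₙ,tₙ)` of a run. -/
def traceW {α Q : Type} (run : List (Step α Q)) : List (α × ℝ≥0) :=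
  run.map fun s => (s.σ, s.t)

/-- The reset-delay-timed word `(σ₁,t₁,b₁)⋯(σₙ,tₙ,bₙ)` of a run. -/
def resetTraceW {α Q : Type} (run : List (Step α Q)) : List (α × ℝ≥0 × Bool) :=
  run.map fun s => (s.σ, s.t, s.b)

/-- The sequence of transitions taken by a run (all data of each step except the delay). -/
def transSeq {α Q : Type} (run : List (Step α Q)) : List (α × ClockConstraint × Bool × Q) :=
  run.map fun s => (s.σ, s.φ, s.b, s.tgt)

namespace OTA

variable {α : Type}

/-- `A.IsRunFrom q ν steps` holds iff `steps` is a run of `A` from the state `(q, ν)`: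
each step takes a transition of `A` whose guard is satisfied by the current clock value
plus the delay, updating the clock valuation (reset to `0` if the reset bit is set). -/
def IsRunFrom (A : OTA α) : A.Q → ℝ≥0 → List (Step α A.Q) → Prop
  | _, _, [] => True
  | q, ν, s :: rest =>
    (q, s.σ, s.φ, s.b, s.tgt) ∈ A.Δ ∧ s.φ.sat (ν + s.t) ∧
      A.IsRunFrom s.tgt (if s.b then 0 else ν + s.t) rest

/-- The recognized (delay-)timed language `𝓛(A)`: traces of accepting runs. -/
def L (A : OTA α) : Set (List (α × ℝ≥0)) :=
  {w | ∃ run : List (Step α A.Q),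
    A.IsRunFrom A.q0 0 run ∧ endLoc A.q0 run ∈ A.F ∧ traceW run = w}

/-- The recognized reset-delay-timed language `𝓛_r(A)`. -/
def Lr (A : OTA α) : Set (List (α × ℝ≥0 × Bool)) :=
  {w | ∃ run : List (Step α A.Q),
    A.IsRunFrom A.q0 0 run ∧ endLoc A.q0 run ∈ A.F ∧ resetTraceW run = w}

/-- `A` is deterministic (a DOTA): guards of distinct transitions out of the same
location with the same action are disjoint. -/
def Deterministic (A : OTA α) : Prop :=
  ∀ q σ φ₁ b₁ q₁ φ₂ b₂ q₂, (q, σ, φ₁, b₁, q₁) ∈ A.Δ → (q, σ, φ₂, b₂, q₂) ∈ A.Δ →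
    (∃ μ, φ₁.sat μ ∧ φ₂.sat μ) → φ₁ = φ₂ ∧ b₁ = b₂ ∧ q₁ = q₂

/-- `A` is complete: for every location, action and clock value, some transition is
enabled (together with `Deterministic`, the guards partition `ℝ≥0`). -/
def Complete (A : OTA α) : Prop :=
  ∀ q σ (μ : ℝ≥0), ∃ φ b q', (q, σ, φ, b, q') ∈ A.Δ ∧ φ.sat μ

end OTA

/-- Auxiliary function for `Γ`, accumulating the current logical clock value. -/
def GammaAux {α : Type} : ℝ≥0 → List (α × ℝ≥0 × Bool) → List (α × ℝ≥0 × Bool)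
  | _, [] => []
  | ν, (σ, t, b) :: rest => (σ, ν + t, b) :: GammaAux (if b then 0 else ν + t) rest

/-- The map `Γ` from reset-delay-timed words to reset-logical-timed words:
`μ₁ = t₁`, and `μᵢ = tᵢ` if `b_{i-1} = ⊤`, `μᵢ = μ_{i-1} + tᵢ` otherwise. -/
def Gamma {α : Type} (w : List (α × ℝ≥0 × Bool)) : List (α × ℝ≥0 × Bool) :=
  GammaAux 0 w

/-- Auxiliary function for the inverse of `Γ`, accumulating the previous logical clock
value (or `0` after a reset). -/
noncomputable def GammaInvAux {α : Type} : ℝ≥0 → List (α × ℝ≥0 × Bool) → List (α × ℝ≥0 × Bool)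
  | _, [] => []
  | prev, (σ, μ, b) :: rest => (σ, μ - prev, b) :: GammaInvAux (if b then 0 else μ) rest

/-- The inverse of `Γ`: `t₁ = μ₁`, and for `i ≥ 2`, `tᵢ = μᵢ` if `b_{i-1} = ⊤` and
`tᵢ = μᵢ - μ_{i-1}` otherwise. -/
noncomputable def GammaInv {α : Type} (w : List (α × ℝ≥0 × Bool)) : List (α × ℝ≥0 × Bool) :=
  GammaInvAux 0 w

/-- The set of reset-logical-timed words: words `(σᵢ,μᵢ,bᵢ)_{i=1..n}` satisfying
`μᵢ ≥ μ_{i-1}` whenever `2 ≤ i ≤ n` and `b_{i-1} = ⊥`. -/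
def LogicalWords (α : Type) : Set (List (α × ℝ≥0 × Bool)) :=
  {w | List.Chain' (fun p q => p.2.2 = false → p.2.1 ≤ q.2.1) w}

/-- The interval of the partition function determined by the left base point `a` and
the right endpoint `b` (`none` standing for `∞`). -/
noncomputable def PInterval (a : ℝ≥0) (b : Option ℝ≥0) : Set ℝ≥0 :=
  match b with
  | none => if (⌊a⌋₊ : ℝ≥0) = a then Set.Ici a else Set.Ioi (⌊a⌋₊ : ℝ≥0)
  | some b =>
    if (⌊a⌋₊ : ℝ≥0) = a then
      if (⌊b⌋₊ : ℝ≥0) = b then Set.Ico a b else Set.Icc a (⌊b⌋₊ : ℝ≥0)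
    else
      if (⌊b⌋₊ : ℝ≥0) = b then Set.Ioo (⌊a⌋₊ : ℝ≥0) b
      else Set.Ioc (⌊a⌋₊ : ℝ≥0) (⌊b⌋₊ : ℝ≥0)

theorem mem_region_bounds {μ μ' : ℝ≥0} (h : μ' ∈ region μ) (m : ℕ) :
    (μ' < m ↔ μ < m) ∧ (m < μ' ↔ m < μ) := by
  unfold region at h
  split_ifs at h with hμ
  · rw [Set.mem_singleton_iff.mp h]
    simp
  · obtain ⟨h₁, h₂⟩ := h
    have hlow : (⌊μ⌋₊ : ℝ≥0) < μ := lt_of_le_of_ne (Nat.floor_le zero_le) hμ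
    have hupp : μ < (⌊μ⌋₊ : ℝ≥0) + 1 := Nat.lt_floor_add_one μ
    rcases le_or_gt m ⌊μ⌋₊ with hm | hm
    · have hm' : (m : ℝ≥0) ≤ ⌊μ⌋₊ := by exact_mod_cast hm
      exact ⟨iff_of_false (hm'.trans_lt h₁).not_gt (hm'.trans_lt hlow).not_gt,
        iff_of_true (hm'.trans_lt h₁) (hm'.trans_lt hlow)⟩
    · have hm' : (⌊μ⌋₊ : ℝ≥0) + 1 ≤ m := by exact_mod_cast hm
      exact ⟨iff_of_true (h₂.trans_le hm') (hupp.trans_le hm'),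
        iff_of_false (h₂.trans_le hm').not_gt (hupp.trans_le hm').not_gt⟩

theorem ClockConstraint.sat_of_mem_region {μ μ' : ℝ≥0} (h : μ' ∈ region μ)
    (φ : ClockConstraint) (hφ : φ.sat μ) : φ.sat μ' := by
  induction φ with
  | top => trivial
  | eq m =>
    obtain ⟨h₁, h₂⟩ := mem_region_bounds h m
    have hμ : μ = m := hφ
    exact le_antisymm (not_lt.mp fun hlt => (h₂.mp hlt).ne' hμ)
      (not_lt.mp fun hlt => (h₁.mp hlt).ne hμ)
  | lt m => exact (mem_region_bounds h m).1.mpr hφ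
  | gt m => exact (mem_region_bounds h m).2.mpr hφ
  | le m => exact not_lt.mp fun hlt => not_lt.mpr hφ ((mem_region_bounds h m).2.mp hlt)
  | ge m => exact not_lt.mp fun hlt => not_lt.mpr hφ ((mem_region_bounds h m).1.mp hlt)
  | conj φ₁ φ₂ ih₁ ih₂ => exact ⟨ih₁ hφ.1, ih₂ hφ.2⟩

theorem endLoc_eq_foldl_transSeq {α Q : Type} (q : Q) (r : List (Step α Q)) :
    endLoc q r = (transSeq r).foldl (fun _ x => x.2.2.2) q := by
  simp [endLoc, transSeq, List.foldl_map]

theorem OTA.IsRunFrom.exists_of_forall₂_region {α : Type} (A : OTA α)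
    (r : List (Step α A.Q)) (q : A.Q) (ν ν' : ℝ≥0) (hr : A.IsRunFrom q ν r)
    (γ' : List (α × ℝ≥0 × Bool))
    (hmatch : List.Forall₂
      (fun x y => x.1 = y.1 ∧ x.2.2 = y.2.2 ∧ y.2.1 ∈ region x.2.1)
      (GammaAux ν (resetTraceW r)) γ')
    (hfirst : ∀ x ∈ γ'.head?, ν' ≤ x.2.1)
    (hchain : List.IsChain (fun p q => p.2.2 = false → p.2.1 ≤ q.2.1) γ') :
    ∃ r' : List (Step α A.Q), A.IsRunFrom q ν' r' ∧ transSeq r' = transSeq r ∧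
      GammaAux ν' (resetTraceW r') = γ' := by
  induction r generalizing q ν ν' γ' with
  | nil =>
    cases hmatch
    exact ⟨[], trivial, rfl, rfl⟩
  | cons s rest ih =>
    obtain ⟨hΔ, hsat, hrest⟩ := hr
    obtain _ | @⟨_, ⟨σ, μ, b⟩, _, γ, ⟨hσ, hb, hμ⟩, htail⟩ := hmatch
    dsimp only at hσ hb hμ
    subst hσ hb
    have hle : ν' ≤ μ := hfirst _ rfl
    rw [List.isChain_cons] at hchain
    obtain ⟨r', hrun, htrans, hgamma⟩ := ih s.tgt _ (if s.b then 0 else μ) hrest γ htail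
      (fun y hy => by
        split_ifs with h
        · exact zero_le
        · exact hchain.1 y hy (by simpa using h))
      hchain.2
    have hadd : ν' + (μ - ν') = μ := add_tsub_cancel_of_le hle
    refine ⟨⟨μ - ν', s.σ, s.φ, s.b, s.tgt⟩ :: r', ⟨hΔ, ?_, ?_⟩, ?_, ?_⟩
    · rw [hadd]
      exact s.φ.sat_of_mem_region hμ hsat
    · rwa [hadd]
    · simpa [transSeq] using htrans
    · simpa [resetTraceW, GammaAux, hadd] using hgamma

/-- Region-invariance of runs: if `r` is a run of an OTA `A` from the
initial state with reset-logical-timed word `γ = Γ(trace_r(r))`, and `γ'` is a word with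
the same actions and reset bits whose clock values lie in the regions of those of `γ`
(with `μ₁' ≥ 0`, and `μᵢ' ≥ μ_{i-1}'` whenever `b_{i-1} = ⊥`), then there is a run `r'`
from the initial state taking exactly the same sequence of transitions whose
reset-logical-timed word is `γ'`; in particular `r'` is accepting iff `r` is. -/
theorem run_region_invariant {α : Type} [Finite α] (A : OTA α)
    (r : List (Step α A.Q)) (hr : A.IsRunFrom A.q0 0 r)
    (γ' : List (α × ℝ≥0 × Bool))
    (hmatch : List.Forall₂
      (fun x y => x.1 = y.1 ∧ x.2.2 = y.2.2 ∧ y.2.1 ∈ region x.2.1)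
      (Gamma (resetTraceW r)) γ')
    (hfirst : ∀ x ∈ γ'.head?, (0 : ℝ≥0) ≤ x.2.1)
    (hchain : List.Chain' (fun p q => p.2.2 = false → p.2.1 ≤ q.2.1) γ') :
    ∃ r' : List (Step α A.Q), A.IsRunFrom A.q0 0 r' ∧ transSeq r' = transSeq r ∧
      Gamma (resetTraceW r') = γ' ∧
      (endLoc A.q0 r' ∈ A.F ↔ endLoc A.q0 r ∈ A.F) := by
  obtain ⟨r', hrun, htrans, hgamma⟩ :=
    OTA.IsRunFrom.exists_of_forall₂_region A r A.q0 0 0 hr γ' hmatch hfirst hchain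
  refine ⟨r', hrun, htrans, hgamma, ?_⟩
  rw [endLoc_eq_foldl_transSeq, endLoc_eq_foldl_transSeq, htrans]
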